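/- arXiv:math/0610489 — 8 statements merged into one kernel-verified Lean document; each statement's English description precedes it below -/
import Mathlib

section
/- Let φ = gaussianReal 0 1 and for t ≥ 0 define the Mehler (Ornstein–Uhlenbeck) semigroup by P_t f(x) = ∫ f(e^{−t} x + √(1 − e^{−2t}) y) dφ(y). Then for all bounded measurable f, g : ℝ → ℝ and all t ≥ 0, ∫ (P_t f)(x) g(x) dφ(x) = ∫ f(x) (P_t g)(x) dφ(x). (Symmetry of the Ornstein–Uhlenbeck semigroup with respect to the standard Gaussian measure.) -/
open MeasureTheory ProbabilityTheory Filter Set Topology Real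

/-- The Mehler (Ornstein–Uhlenbeck) semigroup
`P_t f (x) = ∫ f(e^{−t} x + √(1 − e^{−2t}) y) dφ(y)`, `φ = N(0,1)`. -/
noncomputable def mehler (t : ℝ) (f : ℝ → ℝ) (x : ℝ) : ℝ :=
  ∫ y, f (Real.exp (-t) * x + Real.sqrt (1 - Real.exp (-2 * t)) * y) ∂(gaussianReal 0 1)

/-- The joint law of two independent standard Gaussians pairs `f (c x + s y)` with `g x` in the
same way as `f x` with `g (c x + s y)`, for `(c, s)` on the unit circle. -/
theorem integral_prod_gaussianReal_cos_sin_symm {f g : ℝ → ℝ} (hf : Measurable f)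
    (hg : Measurable g) (θ : ℝ) :
    ∫ p : ℝ × ℝ, f (Real.cos θ * p.1 + Real.sin θ * p.2) * g p.1
        ∂((gaussianReal 0 1).prod (gaussianReal 0 1))
      = ∫ p : ℝ × ℝ, f p.1 * g (Real.cos θ * p.1 + Real.sin θ * p.2)
        ∂((gaussianReal 0 1).prod (gaussianReal 0 1)) := by
  have hrot := IsGaussian.map_rotation_eq_self (μ := gaussianReal 0 1) (by simp) (-θ)
  have hneg : MeasurePreserving (fun x : ℝ ↦ -x) (gaussianReal 0 1) (gaussianReal 0 1) :=
    ⟨measurable_neg, by simpa using gaussianReal_map_neg (μ := 0) (v := 1)⟩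
  have hflip := ((MeasurePreserving.id (gaussianReal 0 1)).prod hneg).map_eq
  conv_lhs => rw [← hrot]
  conv_rhs => rw [← hflip]
  rw [integral_map (by fun_prop)
      (Measurable.aestronglyMeasurable (by fun_prop)),
    integral_map (by fun_prop) (Measurable.aestronglyMeasurable (by fun_prop))]
  refine integral_congr_ae (ae_of_all _ fun p ↦ ?_)
  simp only [ContinuousLinearMap.rotation_apply, smul_eq_mul, Real.cos_neg, Real.sin_neg,
    Prod.map, id_eq]
  congr 2
  · linear_combination p.1 * Real.sin_sq_add_cos_sq θ
  · ring

theorem integrable_comp_mul_prod_gaussianReal {f g : ℝ → ℝ} (hf : Measurable f)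
    (hg : Measurable g) {Cf Cg : ℝ} (hfb : ∀ x, |f x| ≤ Cf) (hgb : ∀ x, |g x| ≤ Cg)
    (a b : ℝ) :
    Integrable (fun p : ℝ × ℝ ↦ f (a * p.1 + b * p.2) * g p.1)
      ((gaussianReal 0 1).prod (gaussianReal 0 1)) := by
  refine Integrable.of_bound (Measurable.aestronglyMeasurable (by fun_prop)) (Cf * Cg)
    (ae_of_all _ fun p ↦ ?_)
  rw [Real.norm_eq_abs, abs_mul]
  exact mul_le_mul (hfb _) (hgb _) (abs_nonneg _) ((abs_nonneg _).trans (hfb 0))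

/-- The pairing of `P_t f` with `g` as an integral over a product space. -/
theorem integral_mehler_mul {f g : ℝ → ℝ} (hf : Measurable f) (hg : Measurable g) {Cf Cg : ℝ}
    (hfb : ∀ x, |f x| ≤ Cf) (hgb : ∀ x, |g x| ≤ Cg) (t : ℝ) :
    ∫ x, mehler t f x * g x ∂(gaussianReal 0 1)
      = ∫ p : ℝ × ℝ, f (Real.exp (-t) * p.1 + Real.sqrt (1 - Real.exp (-2 * t)) * p.2) * g p.1
        ∂((gaussianReal 0 1).prod (gaussianReal 0 1)) := by
  rw [integral_prod _ (integrable_comp_mul_prod_gaussianReal hf hg hfb hgb _ _)]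
  simp only [mehler, integral_mul_const]

/-- Symmetry of the Ornstein–Uhlenbeck semigroup with respect to the standard Gaussian
measure: for bounded measurable `f, g` and `t ≥ 0`,
`∫ (P_t f) g dφ = ∫ f (P_t g) dφ`. -/
theorem stmt8 (f g : ℝ → ℝ) (hfmeas : Measurable f) (hgmeas : Measurable g)
    (Cf : ℝ) (hfb : ∀ x, |f x| ≤ Cf) (Cg : ℝ) (hgb : ∀ x, |g x| ≤ Cg)
    (t : ℝ) (ht : 0 ≤ t) :
    ∫ x, mehler t f x * g x ∂(gaussianReal 0 1)
      = ∫ x, f x * mehler t g x ∂(gaussianReal 0 1) := by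
  have hcos : Real.cos (Real.arccos (Real.exp (-t))) = Real.exp (-t) :=
    Real.cos_arccos (by linarith [Real.exp_pos (-t)]) (Real.exp_le_one_iff.mpr (by linarith))
  have hsin : Real.sin (Real.arccos (Real.exp (-t))) = Real.sqrt (1 - Real.exp (-2 * t)) := by
    rw [Real.sin_arccos, ← Real.exp_nat_mul]
    congr 3
    push_cast
    ring
  have hsymm :=
    integral_prod_gaussianReal_cos_sin_symm hfmeas hgmeas (Real.arccos (Real.exp (-t)))
  rw [hcos, hsin] at hsymm
  rw [integral_mehler_mul hfmeas hgmeas hfb hgb, hsymm]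
  simp only [mul_comm (f _)]
  exact (integral_mehler_mul hgmeas hfmeas hgb hfb t).symm
end

section
/- Let φ = gaussianReal 0 1 and for t ≥ 0 define P_t f(x) = ∫ f(e^{−t} x + √(1 − e^{−2t}) y) dφ(y) for bounded measurable f : ℝ → ℝ. Then for all s, t ≥ 0 and all x ∈ ℝ, P_s(P_t f)(x) = P_{s+t} f(x). (Semigroup property of the Mehler/Ornstein–Uhlenbeck semigroup.) -/
open MeasureTheory ProbabilityTheory Filter Set Topology Real

/-- A linear combination of two independent standard normal variables is normal, with
variance the sum of the squares of the coefficients. -/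
lemma integral_integral_gaussianReal_add_mul {E : Type*} [NormedAddCommGroup E] [NormedSpace ℝ E]
    {g : ℝ → E} (hg : StronglyMeasurable g) {C : ℝ} (hC : ∀ x, ‖g x‖ ≤ C)
    {a b c : ℝ} (habc : a ^ 2 + b ^ 2 = c ^ 2) :
    ∫ y, ∫ z, g (a * y + b * z) ∂(gaussianReal 0 1) ∂(gaussianReal 0 1)
      = ∫ y, g (c * y) ∂(gaussianReal 0 1) := by
  have hconv : (gaussianReal 0 1).map (a * ·) ∗ (gaussianReal 0 1).map (b * ·)
      = (gaussianReal 0 1).map (c * ·) := by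
    simp only [gaussianReal_map_const_mul, gaussianReal_conv_gaussianReal]
    congr 1
    · simp
    · ext
      simpa using habc
  have hprob (r : ℝ) : IsProbabilityMeasure ((gaussianReal 0 1).map (r * ·)) :=
    Measure.isProbabilityMeasure_map (by fun_prop)
  have hint : Integrable g
      ((gaussianReal 0 1).map (a * ·) ∗ (gaussianReal 0 1).map (b * ·)) := by
    rw [hconv]
    exact .of_bound hg.aestronglyMeasurable C (.of_forall hC)
  have hmap (r : ℝ) {h : ℝ → E} (hh : StronglyMeasurable h) :
      ∫ y, h y ∂((gaussianReal 0 1).map (r * ·)) = ∫ y, h (r * y) ∂(gaussianReal 0 1) :=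
    integral_map (by fun_prop) hh.aestronglyMeasurable
  have hinner (y : ℝ) : ∫ z, g (y + z) ∂((gaussianReal 0 1).map (b * ·))
      = ∫ z, g (y + b * z) ∂(gaussianReal 0 1) :=
    hmap b (hg.comp_measurable (measurable_const_add y))
  have houter : StronglyMeasurable fun y ↦ ∫ z, g (y + b * z) ∂(gaussianReal 0 1) :=
    (hg.comp_measurable (by fun_prop : Measurable fun p : ℝ × ℝ ↦ p.1 + b * p.2)
      ).integral_prod_right'
  rw [← hmap c hg, ← hconv, integral_conv hint]
  simp_rw [hinner]
  exact (hmap a houter).symm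

/-- Semigroup property of the Mehler/Ornstein–Uhlenbeck semigroup: for bounded
measurable `f` and `s, t ≥ 0`, `P_s (P_t f) = P_{s+t} f`. -/
theorem stmt9 (f : ℝ → ℝ) (hfmeas : Measurable f) (C : ℝ) (hfb : ∀ x, |f x| ≤ C)
    (s t : ℝ) (hs : 0 ≤ s) (ht : 0 ≤ t) (x : ℝ) :
    mehler s (mehler t f) x = mehler (s + t) f x := by
  have hle {r : ℝ} (hr : 0 ≤ r) : 0 ≤ 1 - Real.exp (-2 * r) := by
    simpa using hr
  have hvar : (Real.exp (-t) * √(1 - Real.exp (-2 * s))) ^ 2 + √(1 - Real.exp (-2 * t)) ^ 2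
      = √(1 - Real.exp (-2 * (s + t))) ^ 2 := by
    rw [mul_pow, Real.sq_sqrt (hle hs), Real.sq_sqrt (hle ht), Real.sq_sqrt (hle (add_nonneg hs ht)),
      mul_add, Real.exp_add, ← Real.exp_nat_mul]
    push_cast
    ring_nf
  unfold mehler
  rw [← integral_integral_gaussianReal_add_mul
    (g := fun u ↦ f (Real.exp (-(s + t)) * x + u))
    (hfmeas.comp (measurable_const_add _)).stronglyMeasurable (fun u ↦ hfb _) hvar]
  congr! 5 with y z
  rw [neg_add, Real.exp_add]
  ring
end

section
/- Fix T > 0, σ > 0, r ∈ ℝ, and let f : ℝ → ℝ be Borel measurable with linear growth: |f(z)| ≤ C(1 + |z|) for some constant C. Define F(t,x) = e^{−r(T−t)} ∫ f(x · exp((r − σ²/2)(T−t) + σ√(T−t) · y)) dφ(y), with φ = gaussianReal 0 1. Then for each t ∈ [0,T) the function x ↦ F(t,x) is twice continuously differentiable on (0,∞), and for each x > 0 the function t ↦ F(t,x) is continuously differentiable on [0,T) (derivative taken within [0,T)). -/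
open MeasureTheory ProbabilityTheory Filter Set Topology Real

/-- The Black–Scholes value `F(t,x)` at time `t` of the European option with payoff
`f(S_T)` when the stock price at time `t` is `x`, with volatility `σ` and interest
rate `r`, under the martingale measure:
`F(t,x) = e^{−r(T−t)} ∫ f(x e^{(r−σ²/2)(T−t) + σ√(T−t) y}) dφ(y)`, `φ = N(0,1)`. -/
noncomputable def bsF (T σ r : ℝ) (f : ℝ → ℝ) (t x : ℝ) : ℝ :=
  Real.exp (-r * (T - t)) *
    ∫ y, f (x * Real.exp ((r - σ ^ 2 / 2) * (T - t) + σ * Real.sqrt (T - t) * y))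
      ∂(gaussianReal 0 1)

/-- The Laplace-type transform of a signed density `w` is smooth on every open set where it
converges absolutely. -/
lemma contDiffOn_integral_mul_exp {Ω : Type*} [MeasurableSpace Ω] {μ : Measure Ω} {w X : Ω → ℝ}
    (hw : Measurable w) (hX : Measurable X) {U : Set ℝ} (hU : IsOpen U)
    (hint : ∀ s ∈ U, Integrable (fun ω => w ω * exp (s * X ω)) μ) (n : WithTop ℕ∞) :
    ContDiffOn ℝ n (fun s => ∫ ω, w ω * exp (s * X ω) ∂μ) U := by
  have hpart : ∀ g : Ω → ℝ, Measurable g → (∀ ω, |g ω| ≤ |w ω|) → ∀ s ∈ U,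
      Integrable (fun ω => g ω * exp (s * X ω)) μ := by
    intro g hg hgw s hs
    refine (hint s hs).mono (by fun_prop) (Eventually.of_forall fun ω => ?_)
    simp only [norm_mul, Real.norm_eq_abs]
    exact mul_le_mul_of_nonneg_right (hgw ω) (abs_nonneg _)
  have hpos : ∀ g : Ω → ℝ, Measurable g → (∀ ω, |g ω| ≤ |w ω|) →
      ContDiffOn ℝ n (fun s => ∫ ω, max (g ω) 0 * exp (s * X ω) ∂μ) U := by
    intro g hg hgw
    have hmeas : Measurable fun ω => (g ω).toNNReal := hg.real_toNNReal
    set ν : Measure Ω := μ.withDensity fun ω => ((g ω).toNNReal : ENNReal)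
    have hsub : U ⊆ interior (integrableExpSet X ν) := by
      refine hU.subset_interior_iff.2 fun s hs => ?_
      refine (integrable_withDensity_iff_integrable_smul hmeas).2 ?_
      simp only [NNReal.smul_def, Real.coe_toNNReal', smul_eq_mul]
      refine hpart _ (hg.max measurable_const) (fun ω => ?_) s hs
      refine le_trans ?_ (hgw ω)
      rw [abs_of_nonneg (le_max_right _ _)]
      exact max_le (le_abs_self _) (abs_nonneg _)
    refine ((analyticOnNhd_mgf (X := X) (μ := ν)).mono hsub).contDiffOn hU.uniqueDiffOn |>.congr
      fun s _ => ?_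
    simp only [mgf, ν]
    rw [integral_withDensity_eq_integral_smul hmeas]
    simp only [NNReal.smul_def, Real.coe_toNNReal', smul_eq_mul]
  refine ((hpos w hw fun _ => le_rfl).sub
    (hpos (fun ω => -w ω) hw.neg fun ω => (abs_neg _).le)).congr fun s hs => ?_
  rw [← integral_sub]
  · congr 1 with ω
    rw [← sub_mul, max_zero_sub_max_neg_zero_eq_self]
  · refine hpart _ (hw.max measurable_const) (fun ω => ?_) s hs
    rw [abs_of_nonneg (le_max_right _ _)]
    exact max_le (le_abs_self _) (abs_nonneg _)
  · refine hpart _ (hw.neg.max measurable_const) (fun ω => ?_) s hs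
    rw [abs_of_nonneg (le_max_right _ _)]
    exact max_le (neg_le_abs _) (abs_nonneg _)

lemma integrable_exp_linear_sub_quadratic (a : ℝ) {b : ℝ} (hb : 0 < b) :
    Integrable fun z : ℝ => exp (a * z - b * z ^ 2) := by
  have h := (integrable_cexp_quadratic (b := (b : ℂ)) (by simpa using hb) (a : ℂ) 0).norm
  refine h.congr (Eventually.of_forall fun z => ?_)
  simp only [Complex.norm_exp]
  norm_cast
  congr 1
  simp only [add_zero]
  ring

/-- In logarithmic price, a payoff of linear growth is integrable against every Gaussian weight. -/
lemma integrable_comp_exp_mul_exp {f : ℝ → ℝ} (hf : Measurable f) {C : ℝ}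
    (hC : ∀ z, |f z| ≤ C * (1 + |z|)) (a : ℝ) {b : ℝ} (hb : 0 < b) :
    Integrable fun z : ℝ => f (exp z) * exp (a * z - b * z ^ 2) := by
  refine (((integrable_exp_linear_sub_quadratic a hb).add
    (integrable_exp_linear_sub_quadratic (1 + a) hb)).const_mul C).mono' (by fun_prop)
    (Eventually.of_forall fun z => ?_)
  have h := hC (exp z)
  rw [abs_exp] at h
  have hexp : exp ((1 + a) * z - b * z ^ 2) = exp z * exp (a * z - b * z ^ 2) := by
    rw [← exp_add]; congr 1; ring
  simp only [norm_mul, Real.norm_eq_abs, abs_exp, Pi.add_apply, hexp]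
  calc |f (exp z)| * exp (a * z - b * z ^ 2)
      ≤ C * (1 + exp z) * exp (a * z - b * z ^ 2) := by gcongr
    _ = _ := by ring

/-- The Black–Scholes value as a Gaussian integral in the logarithmic terminal price. -/
lemma bsF_eq_integral_exp {T σ : ℝ} (r : ℝ) (f : ℝ → ℝ) {t x : ℝ} (hσ : 0 < σ) (ht : t < T)
    (hx : 0 < x) :
    bsF T σ r f t x = exp (-r * (T - t)) *
      ((√(2 * π * (σ ^ 2 * (T - t))))⁻¹ *
        exp (-(log x + (r - σ ^ 2 / 2) * (T - t)) ^ 2 / (2 * (σ ^ 2 * (T - t)))) *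
      ∫ z, f (exp z) * exp ((log x + (r - σ ^ 2 / 2) * (T - t)) / (σ ^ 2 * (T - t)) * z
        - 1 / (2 * (σ ^ 2 * (T - t))) * z ^ 2)) := by
  have hτ : 0 < T - t := sub_pos.2 ht
  set u := log x + (r - σ ^ 2 / 2) * (T - t) with hu
  have hv : 0 < σ ^ 2 * (T - t) := by positivity
  have hc : σ * √(T - t) ≠ 0 := by positivity
  have hmap : (gaussianReal 0 1).map (fun y => u + σ * √(T - t) * y)
      = gaussianReal u (σ ^ 2 * (T - t)).toNNReal := by
    have : (fun y => u + σ * √(T - t) * y) = (u + ·) ∘ (σ * √(T - t) * ·) := rfl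
    rw [this, ← Measure.map_map (by fun_prop) (by fun_prop), gaussianReal_map_const_mul,
      gaussianReal_map_const_add]
    congr 1
    · ring
    · ext
      simp [mul_pow, Real.sq_sqrt hτ.le, hv.le]
  have hemb : MeasurableEmbedding fun y : ℝ => u + σ * √(T - t) * y :=
    (measurableEmbedding_addLeft u).comp (measurableEmbedding_mulLeft₀ hc)
  have hy : ∀ y, x * exp ((r - σ ^ 2 / 2) * (T - t) + σ * √(T - t) * y)
      = exp (u + σ * √(T - t) * y) := fun y => by
    rw [hu, add_assoc, exp_add (log x), exp_log hx]
  simp only [bsF, hy]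
  rw [← hemb.integral_map (μ := gaussianReal 0 1) (fun z => f (exp z)), hmap,
    integral_gaussianReal_eq_integral_smul (by simpa using hv)]
  congr 1
  rw [← integral_const_mul]
  congr 1 with z
  simp only [gaussianPDFReal, smul_eq_mul, Real.coe_toNNReal _ hv.le]
  rw [show -(z - u) ^ 2 / (2 * (σ ^ 2 * (T - t))) = -u ^ 2 / (2 * (σ ^ 2 * (T - t))) +
      (u / (σ ^ 2 * (T - t)) * z - 1 / (2 * (σ ^ 2 * (T - t))) * z ^ 2) by field_simp; ring,
    exp_add]
  ring

lemma contDiffOn_bsF_price {T σ : ℝ} (r : ℝ) {f : ℝ → ℝ} {t : ℝ} (hσ : 0 < σ) (ht : t < T)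
    (hf : Measurable f) {C : ℝ} (hC : ∀ z, |f z| ≤ C * (1 + |z|)) (n : WithTop ℕ∞) :
    ContDiffOn ℝ n (fun x => bsF T σ r f t x) (Ioi 0) := by
  have hτ : 0 < T - t := sub_pos.2 ht
  have hb : 0 < 1 / (2 * (σ ^ 2 * (T - t))) := by positivity
  have hlog : ContDiffOn ℝ n log (Ioi 0) :=
    contDiffOn_log.mono fun x (hx : 0 < x) => hx.ne'
  have hL : ContDiffOn ℝ n (fun a => ∫ z, f (exp z) *
      exp (-(1 / (2 * (σ ^ 2 * (T - t))) * z ^ 2)) * exp (a * z)) univ := by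
    refine contDiffOn_integral_mul_exp (by fun_prop) measurable_id isOpen_univ (fun a _ => ?_) n
    refine (integrable_comp_exp_mul_exp hf hC a hb).congr (Eventually.of_forall fun z => ?_)
    simp only [id, mul_assoc, ← exp_add]
    ring_nf
  have hu : ContDiffOn ℝ n (fun x => log x + (r - σ ^ 2 / 2) * (T - t)) (Ioi 0) :=
    hlog.add contDiffOn_const
  refine ContDiffOn.congr (f := fun x => exp (-r * (T - t)) *
      ((√(2 * π * (σ ^ 2 * (T - t))))⁻¹ *
        exp (-(log x + (r - σ ^ 2 / 2) * (T - t)) ^ 2 / (2 * (σ ^ 2 * (T - t)))) *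
      ∫ z, f (exp z) * exp (-(1 / (2 * (σ ^ 2 * (T - t))) * z ^ 2)) *
        exp ((log x + (r - σ ^ 2 / 2) * (T - t)) / (σ ^ 2 * (T - t)) * z))) ?_ fun x hx => ?_
  · exact contDiffOn_const.mul ((contDiffOn_const.mul ((hu.pow 2).neg.div_const _).exp).mul
      (hL.comp (hu.div_const _) (mapsTo_univ _ _)))
  · rw [bsF_eq_integral_exp r f hσ ht hx]
    congr 3 with z
    rw [mul_assoc, ← exp_add]
    ring_nf

lemma contDiffOn_bsF_time {T σ : ℝ} (r : ℝ) {f : ℝ → ℝ} {x : ℝ} (hσ : 0 < σ) (hx : 0 < x)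
    (hf : Measurable f) {C : ℝ} (hC : ∀ z, |f z| ≤ C * (1 + |z|)) (n : WithTop ℕ∞) :
    ContDiffOn ℝ n (fun t => bsF T σ r f t x) (Iio T) := by
  have hL : ContDiffOn ℝ n (fun s => ∫ z, f (exp z) * exp ((r - σ ^ 2 / 2) / σ ^ 2 * z) *
      exp (s * (log x * z - z ^ 2 / 2))) (Ioi 0) := by
    refine contDiffOn_integral_mul_exp (by fun_prop) (by fun_prop) isOpen_Ioi (fun s hs => ?_) n
    refine (integrable_comp_exp_mul_exp hf hC ((r - σ ^ 2 / 2) / σ ^ 2 + s * log x)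
      (half_pos hs)).congr (Eventually.of_forall fun z => ?_)
    simp only [mul_assoc, ← exp_add]
    ring_nf
  have hτ : ContDiffOn ℝ n (fun t => T - t) (Iio T) := by fun_prop
  have hv : ContDiffOn ℝ n (fun t => σ ^ 2 * (T - t)) (Iio T) := contDiffOn_const.mul hτ
  have hv0 : ∀ t ∈ Iio T, 0 < σ ^ 2 * (T - t) := fun t ht => by
    have : 0 < T - t := sub_pos.2 ht
    positivity
  have hw : ContDiffOn ℝ n (fun t => √(2 * π * (σ ^ 2 * (T - t)))) (Iio T) :=
    (contDiffOn_const.mul hv).sqrt fun t ht => by have := hv0 t ht; positivity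
  have hu : ContDiffOn ℝ n (fun t => log x + (r - σ ^ 2 / 2) * (T - t)) (Iio T) :=
    contDiffOn_const.add (contDiffOn_const.mul hτ)
  refine ContDiffOn.congr (f := fun t => exp (-r * (T - t)) *
      ((√(2 * π * (σ ^ 2 * (T - t))))⁻¹ *
        exp (-(log x + (r - σ ^ 2 / 2) * (T - t)) ^ 2 / (2 * (σ ^ 2 * (T - t)))) *
      ∫ z, f (exp z) * exp ((r - σ ^ 2 / 2) / σ ^ 2 * z) *
        exp ((σ ^ 2 * (T - t))⁻¹ * (log x * z - z ^ 2 / 2)))) ?_ fun t ht => ?_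
  · refine (contDiffOn_const.mul hτ).exp.mul (((hw.inv fun t ht => ?_).mul
      ((hu.pow 2).neg.div (contDiffOn_const.mul hv) fun t ht => ?_).exp).mul
      (hL.comp (hv.inv fun t ht => (hv0 t ht).ne') fun t ht => inv_pos.2 (hv0 t ht)))
    · have := hv0 t ht
      positivity
    · have := hv0 t ht
      positivity
  · have hτ0 : T - t ≠ 0 := (sub_pos.2 ht).ne'
    rw [bsF_eq_integral_exp r f hσ ht hx]
    congr 3 with z
    rw [mul_assoc, ← exp_add]
    congr 2
    field_simp
    ring

/-- Regularity of the Black–Scholes value function: for `f` Borel measurable with linear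
growth, for each `t ∈ [0,T)` the function `x ↦ F(t,x)` is twice continuously differentiable
on `(0,∞)`, and for each `x > 0` the function `t ↦ F(t,x)` is continuously differentiable
on `[0,T)` (derivative taken within `[0,T)`). -/
theorem stmt11 (T σ r : ℝ) (hT : 0 < T) (hσ : 0 < σ)
    (f : ℝ → ℝ) (hfmeas : Measurable f)
    (C : ℝ) (hgrowth : ∀ z, |f z| ≤ C * (1 + |z|)) :
    (∀ t ∈ Set.Ico (0 : ℝ) T, ContDiffOn ℝ 2 (fun x => bsF T σ r f t x) (Set.Ioi 0)) ∧
    (∀ x : ℝ, 0 < x → ContDiffOn ℝ 1 (fun t => bsF T σ r f t x) (Set.Ico 0 T)) := by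
  exact ⟨fun t ht => contDiffOn_bsF_price r hσ ht.2 hfmeas hgrowth 2,
    fun x hx => (contDiffOn_bsF_time r hσ hx hfmeas hgrowth 1).mono fun t ht => ht.2⟩
end

section
/- Fix T > 0, σ > 0, r ∈ ℝ, and let f : ℝ → ℝ be Borel measurable with linear growth: |f(z)| ≤ C(1 + |z|). Define F(t,x) = e^{−r(T−t)} ∫ f(x · exp((r − σ²/2)(T−t) + σ√(T−t) · y)) dφ(y), with φ = gaussianReal 0 1. Then F satisfies the Black–Scholes partial differential equation ∂F/∂t (t,x) + (σ²x²/2) ∂²F/∂x² (t,x) + r x ∂F/∂x (t,x) − r F(t,x) = 0 for all t ∈ [0,T) and x > 0. -/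
open MeasureTheory ProbabilityTheory Filter Set Topology Real

/-- Measurable functions on `ℝ` of at most exponential growth. -/
def ExpGrowth (g : ℝ → ℝ) : Prop :=
  Measurable g ∧ ∃ C c : ℝ, 0 ≤ C ∧ ∀ u, |g u| ≤ C * rexp (c * |u|)

lemma ExpGrowth.mul_id {g : ℝ → ℝ} (hg : ExpGrowth g) : ExpGrowth fun u => u * g u := by
  obtain ⟨hm, C, c, hC, h⟩ := hg
  refine ⟨measurable_id.mul hm, C, c + 1, hC, fun u => ?_⟩
  have h1 : |u| ≤ rexp |u| := by linarith [Real.add_one_le_exp |u|]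
  calc |u * g u| = |u| * |g u| := abs_mul _ _
    _ ≤ rexp |u| * (C * rexp (c * |u|)) := by gcongr; exact h u
    _ = C * rexp ((c + 1) * |u|) := by rw [add_mul, Real.exp_add, one_mul]; ring

lemma ExpGrowth.integrable_mul_exp_abs {g : ℝ → ℝ} (hg : ExpGrowth g) {a : ℝ} (ha : 0 < a)
    (k : ℝ) : Integrable fun u => g u * rexp (-a * u ^ 2 + k * |u|) := by
  obtain ⟨hm, C, c, hC, h⟩ := hg
  have hi : Integrable fun u : ℝ =>
      C * rexp ((c + k) ^ 2 / (2 * a)) * rexp (-(a / 2) * u ^ 2) :=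
    (integrable_exp_neg_mul_sq (half_pos ha)).const_mul _
  refine hi.mono' (by fun_prop) (Eventually.of_forall fun u => ?_)
  have key : (c + k) * |u| ≤ (c + k) ^ 2 / (2 * a) + a / 2 * u ^ 2 := by
    rw [← sub_nonneg, ← sq_abs u]
    have : (c + k) ^ 2 / (2 * a) + a / 2 * |u| ^ 2 - (c + k) * |u|
        = (c + k - a * |u|) ^ 2 / (2 * a) := by field_simp; ring
    rw [this]; positivity
  calc ‖g u * rexp (-a * u ^ 2 + k * |u|)‖
      = |g u| * rexp (-a * u ^ 2 + k * |u|) := by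
        rw [Real.norm_eq_abs, abs_mul, abs_of_pos (Real.exp_pos _)]
    _ ≤ C * rexp (c * |u|) * rexp (-a * u ^ 2 + k * |u|) := by gcongr; exact h u
    _ = C * rexp (-a * u ^ 2 + (c + k) * |u|) := by
        rw [mul_assoc, ← Real.exp_add]; ring_nf
    _ ≤ C * rexp ((c + k) ^ 2 / (2 * a) + -(a / 2) * u ^ 2) := by
        gcongr ?_ * rexp ?_; linarith
    _ = _ := by rw [Real.exp_add, mul_assoc]

lemma ExpGrowth.integrable_mul_exp {g : ℝ → ℝ} (hg : ExpGrowth g) {a : ℝ} (ha : 0 < a)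
    (b : ℝ) : Integrable fun u => g u * rexp (-a * u ^ 2 + b * u) := by
  have hm := hg.1
  refine (hg.integrable_mul_exp_abs ha |b|).mono (by fun_prop) (Eventually.of_forall fun u => ?_)
  simp only [norm_mul, Real.norm_eq_abs, Real.abs_exp]
  gcongr ?_ * rexp (_ + ?_)
  exact (le_abs_self _).trans_eq (abs_mul _ _)

/-- The two-parameter Laplace transform `(a, b) ↦ ∫ g(u) exp(-a u² + b u) du`. -/
noncomputable def quadLaplace (g : ℝ → ℝ) (a b : ℝ) : ℝ :=
  ∫ u, g u * rexp (-a * u ^ 2 + b * u)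

lemma hasFDerivAt_quadLaplace {g : ℝ → ℝ} (hg : ExpGrowth g) {a : ℝ} (ha : 0 < a) (b : ℝ) :
    HasFDerivAt (fun p : ℝ × ℝ => quadLaplace g p.1 p.2)
      (quadLaplace (fun u => u * (u * g u)) a b • -ContinuousLinearMap.fst ℝ ℝ ℝ
        + quadLaplace (fun u => u * g u) a b • ContinuousLinearMap.snd ℝ ℝ ℝ) (a, b) := by
  have hm := hg.1
  have h1 := hg.mul_id
  have h2 := h1.mul_id
  let F' : ℝ × ℝ → ℝ → ℝ × ℝ →L[ℝ] ℝ := fun p u =>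
    (u * (u * g u) * rexp (-p.1 * u ^ 2 + p.2 * u)) • -ContinuousLinearMap.fst ℝ ℝ ℝ
      + (u * g u * rexp (-p.1 * u ^ 2 + p.2 * u)) • ContinuousLinearMap.snd ℝ ℝ ℝ
  have hint : ∫ u, F' (a, b) u = quadLaplace (fun u => u * (u * g u)) a b •
      -ContinuousLinearMap.fst ℝ ℝ ℝ
        + quadLaplace (fun u => u * g u) a b • ContinuousLinearMap.snd ℝ ℝ ℝ := by
    simp only [F']
    rw [integral_add ((h2.integrable_mul_exp ha b).smul_const _)
      ((h1.integrable_mul_exp ha b).smul_const _), integral_smul_const, integral_smul_const]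
    rfl
  rw [← hint]
  have hs : Ioi (a / 2) ×ˢ Ioo (b - 1) (b + 1) ∈ 𝓝 (a, b) :=
    prod_mem_nhds (Ioi_mem_nhds (by linarith)) (Ioo_mem_nhds (by linarith) (by linarith))
  refine hasFDerivAt_integral_of_dominated_of_fderiv_le (F' := F')
    (bound := fun u => ‖u * (u * g u) * rexp (-(a / 2) * u ^ 2 + (|b| + 1) * |u|)‖
      + ‖u * g u * rexp (-(a / 2) * u ^ 2 + (|b| + 1) * |u|)‖) hs
    (Eventually.of_forall fun p => ?_) (hg.integrable_mul_exp ha b) ?_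
    (Eventually.of_forall fun u p hp => ?_)
    ((h2.integrable_mul_exp_abs (half_pos ha) _).norm.add
      (h1.integrable_mul_exp_abs (half_pos ha) _).norm)
    (Eventually.of_forall fun u p _ => ?_)
  · exact (show Measurable _ by fun_prop).aestronglyMeasurable
  · exact ((h2.integrable_mul_exp ha b).smul_const _).aestronglyMeasurable.add
      ((h1.integrable_mul_exp ha b).smul_const _).aestronglyMeasurable
  · have hexp : rexp (-p.1 * u ^ 2 + p.2 * u) ≤
        rexp (-(a / 2) * u ^ 2 + (|b| + 1) * |u|) := by
      obtain ⟨hp1, hp2, hp3⟩ := hp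
      rw [Real.exp_le_exp]
      have hb : |p.2| ≤ |b| + 1 := by
        rw [abs_le]
        constructor <;> linarith [neg_abs_le b, le_abs_self b]
      have := (le_abs_self (p.2 * u)).trans_eq (abs_mul _ _)
      have := mul_le_mul_of_nonneg_right hb (abs_nonneg u)
      have := mul_le_mul_of_nonneg_right (le_of_lt (mem_Ioi.1 hp1)) (sq_nonneg u)
      linarith
    have hcoef (w : ℝ) : ‖w * rexp (-p.1 * u ^ 2 + p.2 * u)‖ ≤
        ‖w * rexp (-(a / 2) * u ^ 2 + (|b| + 1) * |u|)‖ := by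
      simp only [norm_mul, Real.norm_eq_abs, Real.abs_exp]
      gcongr
    refine (norm_add_le _ _).trans (add_le_add ?_ ?_) <;> rw [norm_smul]
    · rw [norm_neg]
      exact (mul_le_of_le_one_right (norm_nonneg _)
        (ContinuousLinearMap.norm_fst_le ℝ ℝ ℝ)).trans (hcoef _)
    · exact (mul_le_of_le_one_right (norm_nonneg _)
        (ContinuousLinearMap.norm_snd_le ℝ ℝ ℝ)).trans (hcoef _)
  · have hd := ((((hasFDerivAt_fst (𝕜 := ℝ) (p := p)).neg.mul_const (u ^ 2)).add
      ((hasFDerivAt_snd (𝕜 := ℝ) (p := p)).mul_const u)).exp).const_mul (g u)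
    refine hd.congr_fderiv ?_
    ext <;> simp [F'] <;> ring

/-- The transform `quadLaplace` with an additional constant `d` in the exponent. -/
noncomputable def expLaplace (g : ℝ → ℝ) (d a b : ℝ) : ℝ :=
  rexp d * quadLaplace g a b

lemma hasDerivAt_expLaplace {g : ℝ → ℝ} (hg : ExpGrowth g) {D A B : ℝ → ℝ} {D' A' B' s : ℝ}
    (hpos : 0 < A s) (hD : HasDerivAt D D' s) (hA : HasDerivAt A A' s) (hB : HasDerivAt B B' s) :
    HasDerivAt (fun s => expLaplace g (D s) (A s) (B s))
      (D' * expLaplace g (D s) (A s) (B s)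
        - A' * expLaplace (fun u => u * (u * g u)) (D s) (A s) (B s)
        + B' * expLaplace (fun u => u * g u) (D s) (A s) (B s)) s := by
  have h := (hasFDerivAt_quadLaplace hg hpos (B s)).comp_hasDerivAt s (hA.prodMk hB)
  refine (hD.exp.mul h).congr_deriv ?_
  simp [expLaplace]
  ring

lemma expGrowth_comp_exp {f : ℝ → ℝ} (hf : Measurable f) {C : ℝ}
    (hC : ∀ z, |f z| ≤ C * (1 + |z|)) : ExpGrowth fun u => f (rexp u) := by
  have hC0 : 0 ≤ C := by simpa using (abs_nonneg _).trans (hC 0)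
  refine ⟨by fun_prop, 2 * C, 1, by positivity, fun u => (hC _).trans ?_⟩
  have h1 : rexp u ≤ rexp |u| := Real.exp_le_exp.2 (le_abs_self u)
  have h2 : 1 ≤ rexp |u| := Real.one_le_exp (abs_nonneg u)
  rw [Real.abs_exp, one_mul, mul_comm 2 C, mul_assoc]
  gcongr
  linarith

lemma integral_comp_affine_gaussianReal {g : ℝ → ℝ} (hg : Measurable g) (m : ℝ) {s : ℝ}
    (hs : 0 < s) :
    ∫ y, g (m + s * y) ∂(gaussianReal 0 1) =
      rexp (-(1 / 2) * log (2 * π * s ^ 2) - m ^ 2 / (2 * s ^ 2)) *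
        quadLaplace g (1 / (2 * s ^ 2)) (m / s ^ 2) := by
  have hmap : (gaussianReal 0 1).map (fun y => m + s * y) =
      gaussianReal m (.mk (s ^ 2) (sq_nonneg _)) := by
    rw [← Function.comp_def (fun z => m + z) (fun y => s * y),
      ← Measure.map_map (by fun_prop) (by fun_prop), gaussianReal_map_const_mul,
      gaussianReal_map_const_add]
    simp
  rw [← integral_map (φ := fun y => m + s * y) (by fun_prop) hg.aestronglyMeasurable, hmap,
    integral_gaussianReal_eq_integral_smul
      (by rw [Ne, ← NNReal.coe_eq_zero]; exact (pow_pos hs 2).ne'),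
    quadLaplace, ← integral_const_mul]
  congr 1 with u
  have hsqrt : (√(2 * π * s ^ 2))⁻¹ = rexp (-(1 / 2) * log (2 * π * s ^ 2)) := by
    rw [neg_mul, Real.exp_neg, one_div_mul_eq_div, ← Real.log_sqrt (by positivity),
      Real.exp_log (by positivity)]
  simp only [gaussianPDFReal, NNReal.coe_mk, smul_eq_mul]
  rw [hsqrt, mul_left_comm _ (g u), mul_comm _ (g u), ← Real.exp_add, ← Real.exp_add]
  congr 2
  field_simp
  ring

lemma bsF_eq {T σ t x : ℝ} (r : ℝ) {f : ℝ → ℝ} (hσ : 0 < σ) (hf : Measurable f)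
    (ht : t < T) (hx : 0 < x) :
    bsF T σ r f t x =
      expLaplace (fun u => f (rexp u))
        (-r * (T - t) - 1 / 2 * log (2 * π * (σ ^ 2 * (T - t)))
          - (log x + (r - σ ^ 2 / 2) * (T - t)) ^ 2 / (2 * (σ ^ 2 * (T - t))))
        (1 / (2 * (σ ^ 2 * (T - t))))
        ((log x + (r - σ ^ 2 / 2) * (T - t)) / (σ ^ 2 * (T - t))) := by
  have hτ : 0 < T - t := sub_pos.2 ht
  have h := integral_comp_affine_gaussianReal (g := fun u => f (rexp u)) (by fun_prop)
    (log x + (r - σ ^ 2 / 2) * (T - t)) (s := σ * √(T - t)) (by positivity)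
  have hcongr : ∀ y, x * rexp ((r - σ ^ 2 / 2) * (T - t) + σ * √(T - t) * y) =
      rexp (log x + (r - σ ^ 2 / 2) * (T - t) + σ * √(T - t) * y) := fun y => by
    rw [add_assoc, Real.exp_add (log x), Real.exp_log hx]
  simp only [bsF, expLaplace, hcongr]
  rw [h, mul_pow, Real.sq_sqrt hτ.le, ← mul_assoc, ← Real.exp_add]
  ring_nf

/-- Differentiation in the starting point `x` of the lognormal expectation. -/
lemma hasDerivAt_expLaplace_log {g : ℝ → ℝ} (hg : ExpGrowth g) {v : ℝ} (hv : 0 < v) (k c : ℝ)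
    {x : ℝ} (hx : 0 < x) :
    HasDerivAt (fun y => expLaplace g (k - (log y + c) ^ 2 / (2 * v)) (1 / (2 * v))
        ((log y + c) / v))
      ((expLaplace (fun u => u * g u) (k - (log x + c) ^ 2 / (2 * v)) (1 / (2 * v))
            ((log x + c) / v)
          - (log x + c) * expLaplace g (k - (log x + c) ^ 2 / (2 * v)) (1 / (2 * v))
            ((log x + c) / v)) / (v * x)) x := by
  have hm := (Real.hasDerivAt_log hx.ne').add_const c
  have hD : HasDerivAt (fun y => k - (log y + c) ^ 2 / (2 * v)) (-(log x + c) / (v * x)) x := by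
    refine (((hm.pow 2).div_const (2 * v)).const_sub k).congr_deriv ?_
    field_simp
    norm_num [mul_comm]
  have h := hasDerivAt_expLaplace hg (by positivity) hD (hasDerivAt_const x (1 / (2 * v)))
    (hm.div_const v)
  refine h.congr_deriv ?_
  field_simp
  ring

/-- Differentiation in the remaining time `τ` of the lognormal expectation. -/
lemma hasDerivAt_expLaplace_time {g : ℝ → ℝ} (hg : ExpGrowth g) {σ : ℝ} (hσ : 0 < σ)
    (r l c : ℝ) {τ : ℝ} (hτ : 0 < τ) :
    HasDerivAt (fun τ => expLaplace g
        (-r * τ - 1 / 2 * log (2 * π * (σ ^ 2 * τ)) - (l + c * τ) ^ 2 / (2 * (σ ^ 2 * τ)))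
        (1 / (2 * (σ ^ 2 * τ))) ((l + c * τ) / (σ ^ 2 * τ)))
      ((-r - 1 / (2 * τ) + (l ^ 2 - c ^ 2 * τ ^ 2) / (2 * σ ^ 2 * τ ^ 2)) * expLaplace g
          (-r * τ - 1 / 2 * log (2 * π * (σ ^ 2 * τ)) - (l + c * τ) ^ 2 / (2 * (σ ^ 2 * τ)))
          (1 / (2 * (σ ^ 2 * τ))) ((l + c * τ) / (σ ^ 2 * τ))
        - -1 / (2 * σ ^ 2 * τ ^ 2) * expLaplace (fun u => u * (u * g u))
          (-r * τ - 1 / 2 * log (2 * π * (σ ^ 2 * τ)) - (l + c * τ) ^ 2 / (2 * (σ ^ 2 * τ)))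
          (1 / (2 * (σ ^ 2 * τ))) ((l + c * τ) / (σ ^ 2 * τ))
        + -l / (σ ^ 2 * τ ^ 2) * expLaplace (fun u => u * g u)
          (-r * τ - 1 / 2 * log (2 * π * (σ ^ 2 * τ)) - (l + c * τ) ^ 2 / (2 * (σ ^ 2 * τ)))
          (1 / (2 * (σ ^ 2 * τ))) ((l + c * τ) / (σ ^ 2 * τ))) τ := by
  have hid := hasDerivAt_id' τ
  have hv := hid.const_mul (σ ^ 2)
  have hm := (hid.const_mul c).const_add l
  have hv0 : σ ^ 2 * τ ≠ 0 := by positivity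
  refine hasDerivAt_expLaplace hg (by positivity) ?_ ?_ ?_
  · refine (((hid.const_mul (-r)).sub (((hv.const_mul (2 * π)).log (by positivity)).const_mul
      (1 / 2))).sub ((hm.pow 2).div (hv.const_mul 2) (by positivity))).congr_deriv ?_
    simp
    field_simp
    ring
  · refine ((hasDerivAt_const τ (1 : ℝ)).div (hv.const_mul 2) (by positivity)).congr_deriv ?_
    field_simp
    ring
  · refine (hm.div hv hv0).congr_deriv ?_
    field_simp
    ring

/-- The Black–Scholes partial differential equation: for `f` Borel measurable with linear
growth, `∂F/∂t + (σ²x²/2) ∂²F/∂x² + r x ∂F/∂x − r F = 0` for all `t ∈ [0,T)` and `x > 0`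
(the time derivative being taken within `[0,T)`). -/
theorem stmt12 (T σ r : ℝ) (hT : 0 < T) (hσ : 0 < σ)
    (f : ℝ → ℝ) (hfmeas : Measurable f)
    (C : ℝ) (hgrowth : ∀ z, |f z| ≤ C * (1 + |z|)) :
    ∀ t ∈ Set.Ico (0 : ℝ) T, ∀ x : ℝ, 0 < x →
      derivWithin (fun s => bsF T σ r f s x) (Set.Ico 0 T) t
          + σ ^ 2 * x ^ 2 / 2 * deriv (deriv (fun x' => bsF T σ r f t x')) x
          + r * x * deriv (fun x' => bsF T σ r f t x') x
          - r * bsF T σ r f t x = 0 := by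
  intro t ht x hx
  have hg := expGrowth_comp_exp hfmeas hgrowth
  have hτ : 0 < T - t := sub_pos.2 ht.2
  have hv : 0 < σ ^ 2 * (T - t) := by positivity
  have hFt := ((hasDerivAt_expLaplace_time hg hσ r (log x) (r - σ ^ 2 / 2) hτ).comp_const_sub
    T t).congr_of_eventuallyEq (f₁ := fun s => bsF T σ r f s x) (by
      filter_upwards [Iio_mem_nhds ht.2] with s hs
      exact bsF_eq r hσ hfmeas hs hx)
  have hdx (h : ℝ → ℝ) (hh : ExpGrowth h) (y : ℝ) (hy : 0 < y) :=
    hasDerivAt_expLaplace_log hh hv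
      (-r * (T - t) - 1 / 2 * log (2 * π * (σ ^ 2 * (T - t)))) ((r - σ ^ 2 / 2) * (T - t)) hy
  have hFx (y : ℝ) (hy : 0 < y) := (hdx _ hg y hy).congr_of_eventuallyEq
    (f₁ := fun z => bsF T σ r f t z) (by
      filter_upwards [Ioi_mem_nhds hy] with z hz
      exact bsF_eq r hσ hfmeas ht.2 hz)
  have hm := (Real.hasDerivAt_log hx.ne').add_const ((r - σ ^ 2 / 2) * (T - t))
  have hFxx := (((hdx _ hg.mul_id x hx).sub (hm.mul (hdx _ hg x hx))).div
    ((hasDerivAt_id' x).const_mul (σ ^ 2 * (T - t))) (by positivity)).congr_of_eventuallyEq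
    (f₁ := deriv fun z => bsF T σ r f t z) (by
      filter_upwards [Ioi_mem_nhds hx] with y hy
      exact (hFx y hy).deriv)
  rw [hFt.hasDerivWithinAt.derivWithin (uniqueDiffOn_Ico 0 T t ht), hFxx.deriv,
    (hFx x hx).deriv, bsF_eq r hσ hfmeas ht.2 hx]
  simp only [Pi.sub_apply, Pi.mul_apply]
  generalize expLaplace _ _ _ _ = E₀
  generalize expLaplace _ _ _ _ = E₁
  generalize expLaplace _ _ _ _ = E₂
  generalize log x = l
  generalize T - t = τ at *
  field_simp
  ring
end

section
/- Fix T > 0, σ > 0, r ∈ ℝ, and let f : ℝ → ℝ be continuously differentiable and Lipschitz. Define F(t,x) = e^{−r(T−t)} ∫ f(x · exp(g(y))) dφ(y) where g(y) = (r − σ²/2)(T−t) + σ√(T−t) · y and φ = gaussianReal 0 1. Then for all t ∈ [0,T) and x > 0, ∂F/∂x (t,x) = e^{−r(T−t)} ∫ f′(x · exp(g(y))) · exp(g(y)) dφ(y). (Representation of the delta, hence of the hedging portfolio H_t = ∂F/∂x(t,S_t) = e^{−r(T−t)} E[f′(S_T) S_T | F_t] / S_t.) -/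
open MeasureTheory ProbabilityTheory Filter Set Topology Real

/-- Differentiation under the integral sign for `x ↦ ∫ f (x * W)`, with `f` a Lipschitz
`C¹` function and `W` integrable. -/
theorem hasDerivAt_integral_comp_mul_of_lipschitz {Ω : Type*} [MeasurableSpace Ω]
    {μ : Measure Ω} [IsFiniteMeasure μ] {f : ℝ → ℝ} (hf : ContDiff ℝ 1 f) {L : NNReal}
    (hlip : LipschitzWith L f) {W : Ω → ℝ} (hW : Integrable W μ) (x : ℝ) :
    HasDerivAt (fun x' => ∫ a, f (x' * W a) ∂μ) (∫ a, deriv f (x * W a) * W a ∂μ) x := by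
  have hmeas (x' : ℝ) : AEStronglyMeasurable (fun a => f (x' * W a)) μ :=
    hf.continuous.comp_aestronglyMeasurable (hW.aestronglyMeasurable.const_mul x')
  have hint : Integrable (fun a => f (x * W a)) μ := by
    refine (((hW.const_mul x).norm.const_mul (L : ℝ)).add
      (integrable_const ‖f 0‖)).mono' (hmeas x) (.of_forall fun a => ?_)
    have h := hlip.norm_sub_le (x * W a) 0
    rw [sub_zero] at h
    have h' := norm_sub_norm_le (f (x * W a)) (f 0)
    simp only [Pi.add_apply]
    linarith
  refine (hasDerivAt_integral_of_dominated_loc_of_deriv_le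
    (F' := fun x' a => deriv f (x' * W a) * W a) (bound := fun a => L * ‖W a‖) univ_mem
    (.of_forall hmeas) hint ?_ (.of_forall fun a x' _ => ?_)
    (hW.norm.const_mul _) (.of_forall fun a x' _ => ?_)).2
  · exact ((hf.continuous_deriv le_rfl).comp_aestronglyMeasurable
      (hW.aestronglyMeasurable.const_mul x)).mul hW.aestronglyMeasurable
  · rw [norm_mul]
    gcongr
    exact norm_deriv_le_of_lipschitz hlip
  · exact (hf.differentiable one_ne_zero _).hasDerivAt.comp x' (hasDerivAt_mul_const (W a))

/-- Representation of the delta of a European option: for `f` continuously differentiable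
and Lipschitz, for all `t ∈ [0,T)` and `x > 0`,
`∂F/∂x (t,x) = e^{−r(T−t)} ∫ f'(x e^{g(y)}) e^{g(y)} dφ(y)` with
`g(y) = (r−σ²/2)(T−t) + σ√(T−t) y`. -/
theorem stmt14 (T σ r : ℝ) (hT : 0 < T) (hσ : 0 < σ)
    (f : ℝ → ℝ) (hf : ContDiff ℝ 1 f) (L : NNReal) (hlip : LipschitzWith L f) :
    ∀ t ∈ Set.Ico (0 : ℝ) T, ∀ x : ℝ, 0 < x →
      deriv (fun x' => bsF T σ r f t x') x
        = Real.exp (-r * (T - t)) *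
            ∫ y, deriv f (x * Real.exp ((r - σ ^ 2 / 2) * (T - t) + σ * Real.sqrt (T - t) * y))
                * Real.exp ((r - σ ^ 2 / 2) * (T - t) + σ * Real.sqrt (T - t) * y)
              ∂(gaussianReal 0 1) := by
  intro t _ x _
  refine ((hasDerivAt_integral_comp_mul_of_lipschitz hf hlip ?_ x).const_mul _).deriv
  simp only [Real.exp_add]
  exact (integrable_exp_mul_gaussianReal _).const_mul _
end

section
/- Let (Ω, 𝒜, P) carry a filtration (ℱ_t)_{t∈[0,T]} and an adapted process B : [0,T] → Ω → ℝ with B_0 = 0 such that for all 0 ≤ s ≤ t ≤ T the increment B_t − B_s is independent of ℱ_s and has law gaussianReal 0 (t−s). Let S_0 > 0, σ > 0, r ∈ ℝ, set S_t = S_0 · exp(σ B_t + (r − σ²/2)t), and let f : ℝ → ℝ be continuously differentiable and Lipschitz. Define G_t = e^{−2r(T−t)} · σ² t · (E[f′(S_T) S_T | ℱ_t])². Let (tₙ) ⊆ [0,T) be a monotone increasing sequence with tₙ → T, and assume S_T is measurable with respect to ⋁ₙ ℱ_{tₙ}. Then G_{tₙ} → σ² T · f′(S_T)² · S_T² almost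 surely and in L¹(P). (Second assertion of Proposition 4.1: the quadratic error Γ_B[V_t] = (delta_t)² Γ_B[S_t] = e^{−2r(T−t)}(E[f′(S_T)S_T|ℱ_t])²σ²t of the option value under the Ornstein–Uhlenbeck perturbation of the Brownian path converges to f′(S_T)² Γ_B[S_T] = f′(S_T)² S_T² σ² T.) -/
open MeasureTheory ProbabilityTheory Filter Set Topology Real

/-- A sequence dominated almost everywhere by a uniformly integrable one is uniformly integrable. -/
lemma unifIntegrable_of_norm_le {ι Ω E F : Type*} {m0 : MeasurableSpace Ω} {μ : Measure Ω}
    [NormedAddCommGroup E] [NormedAddCommGroup F] {p : ENNReal} {u : ι → Ω → E} {v : ι → Ω → F}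
    (hv : UnifIntegrable v p μ) (h : ∀ i, ∀ᵐ ω ∂μ, ‖u i ω‖ ≤ ‖v i ω‖) :
    UnifIntegrable u p μ := by
  intro ε hε
  obtain ⟨δ, hδ, H⟩ := hv hε
  refine ⟨δ, hδ, fun i s hs hμ => (eLpNorm_mono_ae ?_).trans (H i s hs hμ)⟩
  filter_upwards [h i] with ω hω
  by_cases hmem : ω ∈ s <;> simp [hmem, hω]

/-- Conditional Jensen inequality for the square. -/
lemma sq_condExp_ae_le {Ω : Type*} {m m0 : MeasurableSpace Ω} {μ : Measure Ω} [IsFiniteMeasure μ]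
    (hm : m ≤ m0) {X : Ω → ℝ} (hX : MemLp X 2 μ) :
    ∀ᵐ ω ∂μ, (μ[X | m]) ω ^ 2 ≤ (μ[X ^ 2 | m]) ω := by
  have hnonneg : 0 ≤ᵐ[μ] Var[X; μ | m] :=
    condExp_nonneg (Eventually.of_forall fun ω => sq_nonneg ((X - μ[X | m]) ω))
  filter_upwards [condVar_ae_eq_condExp_sq_sub_sq_condExp hm hX, hnonneg] with ω h1 h2
  rw [h1] at h2
  simpa using h2

/-- Along a filtration, the squares of the conditional expectations of a square integrable
random variable `X` converge in `L¹` to `X ^ 2`. -/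
lemma tendsto_integral_abs_sq_condExp_sub_sq {Ω : Type*} {m0 : MeasurableSpace Ω} {μ : Measure Ω}
    [IsFiniteMeasure μ] (𝒢 : Filtration ℕ m0) {X : Ω → ℝ} (hX : MemLp X 2 μ)
    (hmeas : StronglyMeasurable[⨆ n, 𝒢 n] X) :
    Tendsto (fun n => ∫ ω, |(μ[X | 𝒢 n]) ω ^ 2 - X ω ^ 2| ∂μ) atTop (𝓝 0) := by
  have hmem : ∀ n, MemLp (μ[X | 𝒢 n]) 2 μ := fun n => hX.condExp one_le_two
  have hui : UnifIntegrable (fun n ω => (μ[X | 𝒢 n]) ω ^ 2) 1 μ := by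
    have hsq : UniformIntegrable (fun n => μ[X ^ 2 | 𝒢 n]) 1 μ :=
      hX.integrable_sq.uniformIntegrable_condExp_filtration
    refine unifIntegrable_of_norm_le hsq.2.1 fun n => ?_
    filter_upwards [sq_condExp_ae_le (𝒢.le n) hX] with ω hω
    rw [Real.norm_of_nonneg (sq_nonneg _)]
    exact hω.trans (le_abs_self _)
  have hae : ∀ᵐ ω ∂μ, Tendsto (fun n => (μ[X | 𝒢 n]) ω ^ 2) atTop (𝓝 (X ω ^ 2)) := by
    filter_upwards [(hX.integrable one_le_two).tendsto_ae_condExp hmeas] with ω hω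
    exact hω.pow 2
  have hlim := tendsto_Lp_finite_of_tendsto_ae le_rfl ENNReal.one_ne_top
    (fun n => (hmem n).integrable_sq.aestronglyMeasurable)
    (memLp_one_iff_integrable.2 hX.integrable_sq) hui hae
  have hreal := (ENNReal.tendsto_toReal ENNReal.zero_ne_top).comp hlim
  refine (hreal.congr fun n => ?_)
  rw [Function.comp_apply, eLpNorm_one_eq_lintegral_enorm,
    ← integral_norm_eq_lintegral_enorm
      ((hmem n).integrable_sq.aestronglyMeasurable.sub hX.integrable_sq.aestronglyMeasurable)]
  rfl

/-- Convergence of the quadratic error on the option value (second assertion of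
Proposition 4.1): in the Black–Scholes model driven by a Brownian motion `B` (an adapted
process with `B 0 = 0` whose increments `B_t − B_s` are independent of `ℱ_s` with law
`N(0, t−s)`), with stock price `S_t = S₀ e^{σ B_t + (r−σ²/2)t}` and a `C¹` Lipschitz
payoff `f`, the quadratic error `Γ_B[V_t] = G_t = e^{−2r(T−t)} σ² t (E[f'(S_T) S_T | ℱ_t])²`
of the option value under the Ornstein–Uhlenbeck perturbation of the Brownian path
satisfies `G_{tₙ} → σ² T f'(S_T)² S_T²` almost surely and in `L¹(P)` along any monotone
sequence `tₙ ↑ T` in `[0,T)` such that `S_T` is measurable with respect to `⨆ₙ ℱ_{tₙ}`. -/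
theorem stmt16 {Ω : Type*} {m0 : MeasurableSpace Ω} (P : Measure Ω) [IsProbabilityMeasure P]
    (T : ℝ) (hT : 0 < T) (ℱ : Filtration ℝ m0)
    (B : ℝ → Ω → ℝ)
    (hadapted : ∀ t ∈ Set.Icc (0 : ℝ) T, StronglyMeasurable[ℱ t] (B t))
    (hB0 : ∀ ω, B 0 ω = 0)
    (hindep : ∀ s t : ℝ, 0 ≤ s → s ≤ t → t ≤ T →
      Indep (MeasurableSpace.comap (fun ω => B t ω - B s ω) inferInstance) (ℱ s) P)
    (hlaw : ∀ s t : ℝ, 0 ≤ s → s ≤ t → t ≤ T →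
      P.map (fun ω => B t ω - B s ω) = gaussianReal 0 ((t - s).toNNReal))
    (S₀ σ r : ℝ) (hS₀ : 0 < S₀) (hσ : 0 < σ)
    (S : ℝ → Ω → ℝ)
    (hS : ∀ t ω, S t ω = S₀ * Real.exp (σ * B t ω + (r - σ ^ 2 / 2) * t))
    (f : ℝ → ℝ) (hf : ContDiff ℝ 1 f) (L : NNReal) (hlip : LipschitzWith L f)
    (G : ℝ → Ω → ℝ)
    (hG : ∀ t ω, G t ω = Real.exp (-2 * r * (T - t)) * σ ^ 2 * t *
        ((P[(fun ω' => deriv f (S T ω') * S T ω') | ℱ t]) ω) ^ 2)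
    (tn : ℕ → ℝ) (hmono : Monotone tn) (htn : ∀ n, tn n ∈ Set.Ico (0 : ℝ) T)
    (hlim : Tendsto tn atTop (𝓝 T))
    (hSTmeas : StronglyMeasurable[⨆ n, ℱ (tn n)] (S T)) :
    (∀ᵐ ω ∂P, Tendsto (fun n => G (tn n) ω) atTop
        (𝓝 (σ ^ 2 * T * (deriv f (S T ω)) ^ 2 * (S T ω) ^ 2))) ∧
    Tendsto (fun n =>
        ∫ ω, |G (tn n) ω - σ ^ 2 * T * (deriv f (S T ω)) ^ 2 * (S T ω) ^ 2| ∂P)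
      atTop (𝓝 0) := by
  have hmapT : P.map (B T) = gaussianReal 0 (T.toNNReal) := by
    simpa [hB0] using hlaw 0 T le_rfl hT.le le_rfl
  have hTmem : T ∈ Set.Icc (0 : ℝ) T := ⟨hT.le, le_rfl⟩
  have hBT : Measurable (B T) := ((hadapted T hTmem).mono (ℱ.le T)).measurable
  have hexp : Integrable (fun ω => Real.exp (2 * σ * B T ω)) P := by
    have h : Integrable (fun x => Real.exp (2 * σ * x)) (P.map (B T)) := by
      rw [hmapT]
      exact integrable_exp_mul_gaussianReal _
    exact h.comp_measurable hBT
  have hSm : Measurable (S T) := by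
    have : S T = fun ω => S₀ * Real.exp (σ * B T ω + (r - σ ^ 2 / 2) * T) := funext (hS T)
    rw [this]
    fun_prop
  have hS2 : MemLp (S T) 2 P := by
    rw [memLp_two_iff_integrable_sq hSm.aestronglyMeasurable]
    refine (hexp.const_mul (S₀ ^ 2 * Real.exp (2 * ((r - σ ^ 2 / 2) * T)))).congr
      (Eventually.of_forall fun ω => ?_)
    simp only [hS]
    rw [mul_pow, ← Real.exp_nat_mul, mul_assoc, ← Real.exp_add]
    congr 2
    push_cast
    ring
  set X : Ω → ℝ := fun ω => deriv f (S T ω) * S T ω with hXdef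
  have hdf : Continuous (deriv f) := hf.continuous_deriv le_rfl
  have hXm : StronglyMeasurable[⨆ n, ℱ (tn n)] X :=
    (hdf.comp_stronglyMeasurable hSTmeas).mul hSTmeas
  have hX2 : MemLp X 2 P := by
    refine hS2.of_le_mul (c := L)
      ((hdf.measurable.comp hSm).mul hSm).aestronglyMeasurable (Eventually.of_forall fun ω => ?_)
    rw [hXdef, norm_mul]
    exact mul_le_mul_of_nonneg_right (norm_deriv_le_of_lipschitz hlip) (norm_nonneg _)
  let 𝒢 : Filtration ℕ m0 :=
    ⟨fun n => ℱ (tn n), fun _ _ h => ℱ.mono (hmono h), fun n => ℱ.le (tn n)⟩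
  have hae : ∀ᵐ ω ∂P, Tendsto (fun n => (P[X | ℱ (tn n)]) ω) atTop (𝓝 (X ω)) :=
    (hX2.integrable one_le_two).tendsto_ae_condExp (ℱ := 𝒢) hXm
  have hL1 : Tendsto (fun n => ∫ ω, |(P[X | ℱ (tn n)]) ω ^ 2 - X ω ^ 2| ∂P) atTop (𝓝 0) :=
    tendsto_integral_abs_sq_condExp_sub_sq 𝒢 hX2 hXm
  let c : ℕ → ℝ := fun n => Real.exp (-2 * r * (T - tn n)) * σ ^ 2 * tn n
  have hclim : Tendsto c atTop (𝓝 (σ ^ 2 * T)) := by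
    have hcont : Continuous fun t : ℝ => Real.exp (-2 * r * (T - t)) * σ ^ 2 * t := by fun_prop
    have h := (hcont.tendsto T).comp hlim
    rwa [sub_self, mul_zero, Real.exp_zero, one_mul] at h
  have hGc : ∀ n ω, G (tn n) ω = c n * (P[X | ℱ (tn n)]) ω ^ 2 := fun n ω => hG (tn n) ω
  have htarget : ∀ ω, σ ^ 2 * T * (deriv f (S T ω)) ^ 2 * (S T ω) ^ 2 = σ ^ 2 * T * X ω ^ 2 :=
    fun ω => by rw [hXdef]; ring
  simp only [hGc, htarget]
  refine ⟨?_, ?_⟩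
  · filter_upwards [hae] with ω hω
    exact hclim.mul (hω.pow 2)
  · have hbound : Tendsto (fun n => |c n| * ∫ ω, |(P[X | ℱ (tn n)]) ω ^ 2 - X ω ^ 2| ∂P +
        |c n - σ ^ 2 * T| * ∫ ω, X ω ^ 2 ∂P) atTop (𝓝 0) := by
      have h0 : Tendsto (fun n => |c n - σ ^ 2 * T|) atTop (𝓝 0) := by
        have h := (hclim.sub_const (σ ^ 2 * T)).abs
        rwa [sub_self, abs_zero] at h
      simpa using (hclim.abs.mul hL1).add (h0.mul_const (∫ ω, X ω ^ 2 ∂P))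
    refine squeeze_zero (fun n => integral_nonneg fun ω => abs_nonneg _) (fun n => ?_) hbound
    have hMint : Integrable (fun ω => (P[X | ℱ (tn n)]) ω ^ 2) P :=
      (hX2.condExp one_le_two).integrable_sq
    have hXint : Integrable (fun ω => X ω ^ 2) P := hX2.integrable_sq
    have hdiff : Integrable (fun ω => |(P[X | ℱ (tn n)]) ω ^ 2 - X ω ^ 2|) P :=
      (hMint.sub hXint).abs
    rw [← integral_const_mul, ← integral_const_mul,
      ← integral_add (hdiff.const_mul _) (hXint.const_mul _)]
    refine integral_mono ((hMint.const_mul _).sub (hXint.const_mul _)).abs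
      ((hdiff.const_mul _).add (hXint.const_mul _)) fun ω => ?_
    calc |c n * (P[X | ℱ (tn n)]) ω ^ 2 - σ ^ 2 * T * X ω ^ 2|
        = |c n * ((P[X | ℱ (tn n)]) ω ^ 2 - X ω ^ 2) + (c n - σ ^ 2 * T) * X ω ^ 2| := by
          congr 1
          ring
      _ ≤ _ := abs_add_le _ _
      _ = _ := by rw [abs_mul (c n), abs_mul (c n - σ ^ 2 * T), abs_of_nonneg (sq_nonneg (X ω))]
end

section
/- Let (Ω, 𝒜, P) carry a filtration (ℱ_t)_{t∈[0,T]} and an adapted process B : [0,T] → Ω → ℝ with B_0 = 0 such that for all 0 ≤ s ≤ t ≤ T the increment B_t − B_s is independent of ℱ_s and has law gaussianReal 0 (t−s). Let S_0 > 0, σ > 0, r ∈ ℝ, set S_t = S_0 · exp(σ B_t + (r − σ²/2)t), and let f : ℝ → ℝ be continuously differentiable with f and f′ both Lipschitz. Define the hedging portfolio H_t = e^{−r(T−t)} · E[f′(S_T) S_T | ℱ_t] / S_t. Let (tₙ) ⊆ [0,T) be a monotone increasing sequence with tₙ → T, and assume S_T is measurable with respect to ⋁ₙ ℱ_{tₙ}.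 Then H_{tₙ} → f′(S_T) almost surely and in L¹(P). (First assertion of Proposition 4.2: the hedging portfolio converges to f′(S_T) as t ↑ T.) -/
open MeasureTheory ProbabilityTheory Filter Set Topology Real

/-- The conditional expectation of a geometric Brownian motion at a single pair of times:
if the increment `Y - X` is `N(0, v)` and independent of `m`, and `X` is `m`-measurable, then
`E[e^{σ Y} | m] = e^{σ X + v σ² / 2}`. -/
theorem condExp_exp_of_gaussian_increment {Ω : Type*} {m m0 : MeasurableSpace Ω}
    {P : Measure Ω} [IsProbabilityMeasure P] (hm : m ≤ m0) {X Y : Ω → ℝ} {σ : ℝ} {v : NNReal}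
    (hX : StronglyMeasurable[m] X) (hY : Measurable Y)
    (hindep : Indep (MeasurableSpace.comap (fun ω => Y ω - X ω) inferInstance) m P)
    (hlaw : P.map (fun ω => Y ω - X ω) = gaussianReal 0 v)
    (hint : Integrable (fun ω => Real.exp (σ * Y ω)) P) :
    P[(fun ω => Real.exp (σ * Y ω)) | m] =ᵐ[P]
      fun ω => Real.exp (σ * X ω + v * σ ^ 2 / 2) := by
  have hD : Measurable (fun ω => Y ω - X ω) := hY.sub (hX.measurable.mono hm le_rfl)
  have hmgf : ∫ ω, Real.exp (σ * (Y ω - X ω)) ∂P = Real.exp (v * σ ^ 2 / 2) := by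
    have := mgf_gaussianReal hlaw σ
    simpa [mgf] using this
  have hDint : Integrable (fun ω => Real.exp (σ * (Y ω - X ω))) P := by
    by_contra h
    rw [integral_undef h] at hmgf
    exact (Real.exp_pos _).ne hmgf
  have hprod : (fun ω => Real.exp (σ * Y ω)) =
      (fun ω => Real.exp (σ * X ω)) * fun ω => Real.exp (σ * (Y ω - X ω)) := by
    ext ω
    rw [Pi.mul_apply, ← Real.exp_add]
    ring_nf
  have hDm : StronglyMeasurable[MeasurableSpace.comap (fun ω => Y ω - X ω) inferInstance]
      (fun ω => Real.exp (σ * (Y ω - X ω))) :=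
    ((Real.measurable_exp.comp (measurable_const_mul σ)).comp
      (comap_measurable (fun ω => Y ω - X ω))).stronglyMeasurable
  have hXm : StronglyMeasurable[m] (fun ω => Real.exp (σ * X ω)) :=
    Real.continuous_exp.comp_stronglyMeasurable (hX.const_mul σ)
  rw [hprod] at hint ⊢
  filter_upwards [condExp_mul_of_stronglyMeasurable_left hXm hint hDint,
    condExp_indep_eq hD.comap_le hm hDm hindep] with ω h₁ h₂
  rw [h₁, Pi.mul_apply, h₂, hmgf, Real.exp_add]

/-- If `|G| ≤ C X` for a nonnegative bound, the same holds for conditional expectations. -/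
theorem abs_condExp_le_const_mul_condExp {Ω : Type*} {m m0 : MeasurableSpace Ω}
    {P : Measure Ω} {G X : Ω → ℝ} {C : ℝ} (hG : Integrable G P) (hX : Integrable X P)
    (h : ∀ ω, |G ω| ≤ C * X ω) :
    ∀ᵐ ω ∂P, |(P[G | m]) ω| ≤ C * (P[X | m]) ω := by
  have hCX : Integrable (C • X) P := hX.smul C
  filter_upwards [condExp_mono (m := m) hG hCX (ae_of_all _ fun ω => (abs_le.1 (h ω)).2),
    condExp_mono (m := m) hCX.neg hG (ae_of_all _ fun ω => (abs_le.1 (h ω)).1),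
    condExp_neg (μ := P) (C • X) m, condExp_smul (μ := P) C X m] with ω h₁ h₂ h₃ h₄
  rw [h₃, Pi.neg_apply] at h₂
  rw [h₄, Pi.smul_apply, smul_eq_mul] at h₁ h₂
  exact abs_le.2 ⟨h₂, h₁⟩

/-- Convergence of the hedging portfolio to the derivative of the payoff (first assertion
of Proposition 4.2): in the Black–Scholes model driven by a Brownian motion `B` (an
adapted process with `B 0 = 0` whose increments `B_t − B_s` are independent of `ℱ_s` with
law `N(0, t−s)`), with stock price `S_t = S₀ e^{σ B_t + (r−σ²/2)t}` and a continuously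
differentiable payoff `f` such that `f` and `f'` are Lipschitz, the hedging portfolio
`H_t = e^{−r(T−t)} E[f'(S_T) S_T | ℱ_t] / S_t` satisfies `H_{tₙ} → f'(S_T)` almost surely
and in `L¹(P)` along any monotone sequence `tₙ ↑ T` in `[0,T)` such that `S_T` is
measurable with respect to `⨆ₙ ℱ_{tₙ}`. -/
theorem stmt17 {Ω : Type*} {m0 : MeasurableSpace Ω} (P : Measure Ω) [IsProbabilityMeasure P]
    (T : ℝ) (hT : 0 < T) (ℱ : Filtration ℝ m0)
    (B : ℝ → Ω → ℝ)
    (hadapted : ∀ t ∈ Set.Icc (0 : ℝ) T, StronglyMeasurable[ℱ t] (B t))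
    (hB0 : ∀ ω, B 0 ω = 0)
    (hindep : ∀ s t : ℝ, 0 ≤ s → s ≤ t → t ≤ T →
      Indep (MeasurableSpace.comap (fun ω => B t ω - B s ω) inferInstance) (ℱ s) P)
    (hlaw : ∀ s t : ℝ, 0 ≤ s → s ≤ t → t ≤ T →
      P.map (fun ω => B t ω - B s ω) = gaussianReal 0 ((t - s).toNNReal))
    (S₀ σ r : ℝ) (hS₀ : 0 < S₀) (hσ : 0 < σ)
    (S : ℝ → Ω → ℝ)
    (hS : ∀ t ω, S t ω = S₀ * Real.exp (σ * B t ω + (r - σ ^ 2 / 2) * t))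
    (f : ℝ → ℝ) (hf : ContDiff ℝ 1 f)
    (L L' : NNReal) (hlip : LipschitzWith L f) (hlip' : LipschitzWith L' (deriv f))
    (H : ℝ → Ω → ℝ)
    (hH : ∀ t ω, H t ω = Real.exp (-r * (T - t)) *
        ((P[(fun ω' => deriv f (S T ω') * S T ω') | ℱ t]) ω) / S t ω)
    (tn : ℕ → ℝ) (hmono : Monotone tn) (htn : ∀ n, tn n ∈ Set.Ico (0 : ℝ) T)
    (hlim : Tendsto tn atTop (𝓝 T))
    (hSTmeas : StronglyMeasurable[⨆ n, ℱ (tn n)] (S T)) :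
    (∀ᵐ ω ∂P, Tendsto (fun n => H (tn n) ω) atTop (𝓝 (deriv f (S T ω)))) ∧
    Tendsto (fun n => ∫ ω, |H (tn n) ω - deriv f (S T ω)| ∂P) atTop (𝓝 0) := by
  have hT0 : (0 : ℝ) ≤ T := hT.le
  have hBmeas : ∀ t ∈ Set.Icc (0 : ℝ) T, Measurable (B t) := fun t ht =>
    (hadapted t ht).measurable.mono (ℱ.le t) le_rfl
  have hBT := hBmeas T ⟨hT0, le_rfl⟩
  have hSpos : ∀ t ω, 0 < S t ω := fun t ω => by rw [hS]; positivity
  have hexp_int : Integrable (fun ω => Real.exp (σ * B T ω)) P := by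
    have hl := hlaw 0 T le_rfl hT0 le_rfl
    simp only [hB0, sub_zero] at hl
    have hmgf := mgf_gaussianReal hl σ
    by_contra h
    rw [mgf, integral_undef h] at hmgf
    exact (Real.exp_pos _).ne hmgf
  have hST : S T = (S₀ * Real.exp ((r - σ ^ 2 / 2) * T)) • fun ω => Real.exp (σ * B T ω) := by
    ext ω
    rw [hS, Pi.smul_apply, smul_eq_mul, Real.exp_add]
    ring
  have hSTint : Integrable (S T) P := hST ▸ hexp_int.smul _
  have hSmart : ∀ t ∈ Set.Icc (0 : ℝ) T,
      P[S T | ℱ t] =ᵐ[P] fun ω => Real.exp (r * (T - t)) * S t ω := by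
    intro t ht
    rw [hST]
    filter_upwards [condExp_smul (μ := P) (S₀ * Real.exp ((r - σ ^ 2 / 2) * T))
      (fun ω => Real.exp (σ * B T ω)) (ℱ t),
      condExp_exp_of_gaussian_increment (ℱ.le t) (hadapted t ht) hBT
        (hindep t T ht.1 ht.2 le_rfl) (hlaw t T ht.1 ht.2 le_rfl) hexp_int] with ω h₁ h₂
    rw [h₁, Pi.smul_apply, smul_eq_mul, h₂, hS, Real.coe_toNNReal _ (sub_nonneg.2 ht.2),
      mul_assoc, mul_left_comm (Real.exp _) S₀, ← Real.exp_add, ← Real.exp_add]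
    ring_nf
  have hf'bound : ∀ x, |deriv f x| ≤ L := fun x => by
    simpa using norm_deriv_le_of_lipschitz hlip
  have hGmeas : StronglyMeasurable[⨆ n, ℱ (tn n)] (fun ω => deriv f (S T ω) * S T ω) :=
    (hlip'.continuous.comp_stronglyMeasurable hSTmeas).mul hSTmeas
  have hle : (⨆ n, ℱ (tn n)) ≤ m0 := iSup_le fun n => ℱ.le _
  have hGle : ∀ ω, |deriv f (S T ω) * S T ω| ≤ L * S T ω := fun ω => by
    rw [abs_mul, abs_of_pos (hSpos T ω)]
    exact mul_le_mul_of_nonneg_right (hf'bound _) (hSpos T ω).le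
  have hGint : Integrable (fun ω => deriv f (S T ω) * S T ω) P :=
    (hSTint.const_mul (L : ℝ)).mono' (hGmeas.mono hle).aestronglyMeasurable
      (ae_of_all _ hGle)
  let 𝒢 : Filtration ℕ m0 :=
    { seq := fun n => ℱ (tn n)
      mono' := fun _ _ h => ℱ.mono (hmono h)
      le' := fun n => ℱ.le _ }
  have hIcc : ∀ n, tn n ∈ Set.Icc (0 : ℝ) T := fun n => Set.Ico_subset_Icc_self (htn n)
  have hHratio : ∀ n, ∀ᵐ ω ∂P, H (tn n) ω =
      (P[(fun ω' => deriv f (S T ω') * S T ω') | ℱ (tn n)]) ω / (P[S T | ℱ (tn n)]) ω := by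
    intro n
    filter_upwards [hSmart (tn n) (hIcc n)] with ω h
    rw [hH, h, neg_mul, Real.exp_neg]
    have := (hSpos (tn n) ω).ne'
    field_simp
  have hae : ∀ᵐ ω ∂P, Tendsto (fun n => H (tn n) ω) atTop (𝓝 (deriv f (S T ω))) := by
    filter_upwards [hGint.tendsto_ae_condExp (ℱ := 𝒢) hGmeas,
      hSTint.tendsto_ae_condExp (ℱ := 𝒢) hSTmeas, ae_all_iff.2 hHratio] with ω h₁ h₂ h₃
    have := h₁.div h₂ (hSpos T ω).ne'
    rw [mul_div_cancel_right₀ _ (hSpos T ω).ne'] at this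
    exact this.congr fun n => (h₃ n).symm
  have hHbound : ∀ n, ∀ᵐ ω ∂P, |H (tn n) ω| ≤ L := by
    intro n
    filter_upwards [hHratio n, hSmart (tn n) (hIcc n),
      abs_condExp_le_const_mul_condExp (m := ℱ (tn n)) hGint hSTint hGle] with ω h₁ h₂ h₃
    have hpos : 0 < (P[S T | ℱ (tn n)]) ω := h₂ ▸ mul_pos (Real.exp_pos _) (hSpos _ ω)
    rw [h₁, abs_div, abs_of_pos hpos]
    exact (div_le_iff₀ hpos).2 h₃
  refine ⟨hae, ?_⟩
  have hf'meas : AEStronglyMeasurable (fun ω => deriv f (S T ω)) P :=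
    ((hlip'.continuous.comp_stronglyMeasurable hSTmeas).mono hle).aestronglyMeasurable
  have hHmeas : ∀ n, AEStronglyMeasurable (H (tn n)) P := fun n =>
    ((stronglyMeasurable_condExp.mono (ℱ.le _)).measurable.div
      (stronglyMeasurable_condExp.mono (ℱ.le _)).measurable).aestronglyMeasurable.congr
      ((hHratio n).mono fun _ h => h.symm)
  have hlim0 := tendsto_integral_of_dominated_convergence (μ := P)
    (F := fun n ω => |H (tn n) ω - deriv f (S T ω)|) (f := fun _ => 0)
    (fun _ => (L : ℝ) + L) (fun n => ((hHmeas n).sub hf'meas).norm)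
    (integrable_const _)
    (fun n => by
      filter_upwards [hHbound n] with ω h
      rw [Real.norm_eq_abs, abs_abs]
      exact (abs_sub _ _).trans (add_le_add h (hf'bound _)))
    (by
      filter_upwards [hae] with ω h
      simpa using (h.sub_const (deriv f (S T ω))).abs)
  simpa using hlim0
end

section
/- Let n ∈ ℕ, let f : ℝⁿ → ℝ be continuously differentiable, and let a ∈ ℝⁿ. Then ∫_{[0,1]ⁿ} Σᵢ aᵢ · ∂ᵢf(u) · uᵢ(1 − uᵢ) du = − ∫_{[0,1]ⁿ} f(u) · Σᵢ aᵢ (1 − 2uᵢ) du, where du is n-dimensional Lebesgue measure on the unit cube. (Integration by parts formula on the Monte Carlo sample space (0,1)^ℕ for the error structure with γ[u](x) = x²(1−x)² u′(x)² on each coordinate: E[⟨DF, a⟩] = −E[F Σₙ aₙ(1 − 2Uₙ)], stated for functions of finitely many coordinates.) -/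
open MeasureTheory Filter Set Topology

/-- The derivative of `c * f(u) * uᵢ(1−uᵢ)` by the product rule. -/
theorem hasFDerivAt_const_mul_mul_coord_mul_one_sub {n : ℕ} {f : (Fin n → ℝ) → ℝ}
    {f' : (Fin n → ℝ) →L[ℝ] ℝ} {u : Fin n → ℝ} (hf : HasFDerivAt f f' u) (c : ℝ) (i : Fin n) :
    HasFDerivAt (fun v => c * f v * (v i * (1 - v i)))
      ((c * f u * (1 - 2 * u i)) • ContinuousLinearMap.proj (R := ℝ) (φ := fun _ : Fin n => ℝ) i
        + (c * (u i * (1 - u i))) • f') u := by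
  have hp : HasFDerivAt (fun v : Fin n → ℝ => v i)
      (ContinuousLinearMap.proj (R := ℝ) (φ := fun _ : Fin n => ℝ) i) u := hasFDerivAt_apply i u
  refine ((hf.const_mul c).mul (hp.mul (hp.const_sub 1))).congr_fderiv ?_
  ext v
  simp
  ring

/-- The divergence of a `C¹` vector field on the unit cube with components
`aᵢ f(u) uᵢ(1−uᵢ)`, which vanish on the faces orthogonal to the `i`-th axis, integrates to zero. -/
theorem integral_unitCube_divergence_eq_zero (n : ℕ) (f : (Fin n → ℝ) → ℝ) (hf : ContDiff ℝ 1 f)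
    (a : Fin n → ℝ) :
    ∫ u in Set.Icc (0 : Fin n → ℝ) 1,
        ∑ i, (a i * f u * (1 - 2 * u i)
          + a i * (u i * (1 - u i)) * fderiv ℝ f u (Pi.single i 1)) = 0 := by
  cases n with
  | zero => simp
  | succ n =>
    have hc : Continuous f := hf.continuous
    have hd : Continuous (fderiv ℝ f) := hf.continuous_fderiv one_ne_zero
    have h := integral_divergence_of_hasFDerivAt_off_countable' (0 : Fin (n + 1) → ℝ) 1
      zero_le_one (fun i u => a i * f u * (u i * (1 - u i))) _ ∅ countable_empty
      (fun i => by fun_prop)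
      (fun u _ i => hasFDerivAt_const_mul_mul_coord_mul_one_sub
        (hf.differentiable one_ne_zero u).hasFDerivAt (a i) i)
      (Continuous.integrableOn_Icc (by fun_prop))
    simpa using h

/-- Integration by parts on the Monte Carlo sample space (unit cube): for `f : ℝⁿ → ℝ`
continuously differentiable and `a ∈ ℝⁿ`,
`∫_{[0,1]ⁿ} ∑ᵢ aᵢ ∂ᵢf(u) uᵢ(1−uᵢ) du = −∫_{[0,1]ⁿ} f(u) ∑ᵢ aᵢ(1−2uᵢ) du`,
i.e. `E[⟨DF, a⟩] = −E[F ∑ᵢ aᵢ(1−2Uᵢ)]` for the error structure with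
`γ[u](x) = x²(1−x)² u'(x)²` on each coordinate. -/
theorem stmt18 (n : ℕ) (f : (Fin n → ℝ) → ℝ) (hf : ContDiff ℝ 1 f) (a : Fin n → ℝ) :
    ∫ u in Set.Icc (0 : Fin n → ℝ) 1,
        ∑ i, a i * fderiv ℝ f u (Pi.single i 1) * (u i * (1 - u i))
      = - ∫ u in Set.Icc (0 : Fin n → ℝ) 1, f u * ∑ i, a i * (1 - 2 * u i) := by
  have hc : Continuous f := hf.continuous
  have hd : Continuous (fderiv ℝ f) := hf.continuous_fderiv one_ne_zero
  rw [eq_neg_iff_add_eq_zero, ← integral_add (Continuous.integrableOn_Icc (by fun_prop))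
    (Continuous.integrableOn_Icc (by fun_prop)), ← integral_unitCube_divergence_eq_zero n f hf a]
  congr 1 with u
  rw [Finset.mul_sum, ← Finset.sum_add_distrib]
  exact Finset.sum_congr rfl fun i _ => by ring
end
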